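/- Let G be a graph containing a cycle. Then G has a tree-decomposition (T, V) of width tw(G) such that every part V_t is contained in a connected vertex set of size at most tw(G)·⌊ℓ(G)/2⌋ + 1. Consequently, the weak connected tree-width of G satisfies wctw(G) ≤ tw(G)·⌊ℓ(G)/2⌋. -/

import Mathlib

open SimpleGraph

universe u

/-- `x` and `y` are joined by a walk in `G` all of whose vertices lie in `S`. -/
def ConnIn {V : Type u} (G : SimpleGraph V) (S : Set V) (x y : V) : Prop :=
  ∃ p : G.Walk x y, ∀ v ∈ p.support, v ∈ S

/-- `S` is a (nonempty) connected vertex set of `G`, i.e. `G[S]` is connected. -/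
def IsConnSet {V : Type u} (G : SimpleGraph V) (S : Set V) : Prop :=
  S.Nonempty ∧ ∀ x ∈ S, ∀ y ∈ S, ConnIn G S x y

/-- A tree-decomposition of `G` over the tree `T`. -/
structure TreeDecomp {V ι : Type u} (G : SimpleGraph V) (T : SimpleGraph ι) where
  isTree : T.IsTree
  bag : ι → Set V
  exists_bag : ∀ v : V, ∃ t, v ∈ bag t
  exists_bag_adj : ∀ ⦃u v : V⦄, G.Adj u v → ∃ t, u ∈ bag t ∧ v ∈ bag t
  bag_sep : ∀ ⦃t₁ t₃ : ι⦄ (p : T.Walk t₁ t₃), p.IsPath → ∀ t₂ ∈ p.support,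
      bag t₁ ∩ bag t₃ ⊆ bag t₂

/-- The union of the bags `B u` over `u ∈ A`. -/
def unionBags {V ι : Type u} (B : ι → Set V) (A : Set ι) : Set V := ⋃ u ∈ A, B u

/-- `s` is a descendant of `t` in the tree `T` rooted at `r`:
`t` lies on the (unique) `r`–`s` path. -/
def Desc {ι : Type u} (T : SimpleGraph ι) (r t s : ι) : Prop :=
  ∃ p : T.Walk r s, p.IsPath ∧ t ∈ p.support

/-- The set of descendants of `t` (the subtree `T_t`). -/
def descSet {ι : Type u} (T : SimpleGraph ι) (r t : ι) : Set ι := {s | Desc T r t s}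

/-- `s` is a child of `t` in the tree `T` rooted at `r`. -/
def IsChild {ι : Type u} (T : SimpleGraph ι) (r t s : ι) : Prop :=
  T.Adj t s ∧ Desc T r t s

/-- The vertex set of the component of `t₁` in `T` minus the edge `t₁t₂`. -/
def Side {ι : Type u} (T : SimpleGraph ι) (t₁ t₂ : ι) : Set ι :=
  {u | ∃ p : T.Walk u t₁, p.IsPath ∧ t₂ ∉ p.support}

/-- The family of bags `B` is stable: for every tree edge `t₁t₂`, both sides
induce connected subgraphs of `G`. -/
def StableBags {V ι : Type u} (G : SimpleGraph V) (T : SimpleGraph ι) (B : ι → Set V) : Prop :=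
  ∀ ⦃t₁ t₂ : ι⦄, T.Adj t₁ t₂ → IsConnSet G (unionBags B (Side T t₁ t₂))

def TreeDecomp.Stable {V ι : Type u} {G : SimpleGraph V} {T : SimpleGraph ι}
    (td : TreeDecomp G T) : Prop :=
  StableBags G T td.bag

/-- `P` is a `t`-admissible path (w.r.t. the root `r` and bags `B`): a shortest
path lying in `V_{T_t}` joining two distinct components of `G[B t]`. -/
structure IsAdmissible {V ι : Type u} (G : SimpleGraph V) (T : SimpleGraph ι)
    (B : ι → Set V) (r t : ι) {x y : V} (P : G.Walk x y) : Prop where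
  isPath : P.IsPath
  support_sub : ∀ v ∈ P.support, v ∈ unionBags B (descSet T r t)
  fst_mem : x ∈ B t
  snd_mem : y ∈ B t
  not_conn : ¬ ConnIn G (B t) x y
  minimal : ∀ ⦃x' y' : V⦄ (Q : G.Walk x' y'), Q.IsPath →
      (∀ v ∈ Q.support, v ∈ unionBags B (descSet T r t)) →
      x' ∈ B t → y' ∈ B t → ¬ ConnIn G (B t) x' y' → P.length ≤ Q.length

/-- The updated bags obtained by adding the path `P` as in `(*)`:
`W_u = V_u ∪ (V(P) ∩ V_{T_u})` for descendants `u` of `t`, and `W_u = V_u` otherwise. -/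
def updatedBag {V ι : Type u} (T : SimpleGraph ι) (B : ι → Set V) (r t : ι)
    {G : SimpleGraph V} {x y : V} (P : G.Walk x y) (u : ι) : Set V :=
  B u ∪ {v | Desc T r t u ∧ v ∈ P.support ∧ v ∈ unionBags B (descSet T r u)}

/-- The tree-width of `G`: the least `k` such that `G` has a tree-decomposition
all of whose bags have at most `k + 1` vertices. -/
noncomputable def treewidth {V : Type u} (G : SimpleGraph V) : ℕ :=
  sInf {k | ∃ (ι : Type u) (T : SimpleGraph ι) (td : TreeDecomp G T),
    ∀ t, (td.bag t).ncard ≤ k + 1}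

/-- A tree-decomposition is connected if every bag is a connected vertex set. -/
def TreeDecomp.IsConn {V ι : Type u} {G : SimpleGraph V} {T : SimpleGraph ι}
    (td : TreeDecomp G T) : Prop :=
  ∀ t, IsConnSet G (td.bag t)

/-- The connected tree-width of `G`. -/
noncomputable def ctw {V : Type u} (G : SimpleGraph V) : ℕ :=
  sInf {k | ∃ (ι : Type u) (T : SimpleGraph ι) (td : TreeDecomp G T),
    td.IsConn ∧ ∀ t, (td.bag t).ncard ≤ k + 1}

/-- The weak connected tree-width of `G`: the least `k` such that `G` has a
tree-decomposition each of whose bags is contained in a connected set of at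
most `k + 1` vertices. -/
noncomputable def wctw {V : Type u} (G : SimpleGraph V) : ℕ :=
  sInf {k | ∃ (ι : Type u) (T : SimpleGraph ι) (td : TreeDecomp G T),
    ∀ t, ∃ X, td.bag t ⊆ X ∧ IsConnSet G X ∧ X.ncard ≤ k + 1}

/-- The characteristic vector over GF(2) of the edge set of a walk. -/
noncomputable def walkChar {V : Type u} {G : SimpleGraph V} {x y : V}
    (p : G.Walk x y) : Sym2 V → ZMod 2 :=
  fun e => by classical exact if e ∈ p.edges then 1 else 0

/-- The characteristic vectors of the cycles of `G` of length at most `ℓ`. -/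
def cycleChars {V : Type u} (G : SimpleGraph V) (ℓ : ℕ) : Set (Sym2 V → ZMod 2) :=
  {f | ∃ (v : V) (p : G.Walk v v), p.IsCycle ∧ p.length ≤ ℓ ∧ f = walkChar p}

/-- The cycles of length at most `ℓ` generate the cycle space of `G` over GF(2). -/
def GeneratesLE {V : Type u} (G : SimpleGraph V) (ℓ : ℕ) : Prop :=
  ∀ ⦃v : V⦄ (p : G.Walk v v), p.IsCycle →
    walkChar p ∈ Submodule.span (ZMod 2) (cycleChars G ℓ)

/-- `ℓ(G)`: the least `ℓ` such that the cycles of length at most `ℓ`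
generate the cycle space of `G`. -/
noncomputable def ellGraph {V : Type u} (G : SimpleGraph V) : ℕ :=
  sInf {ℓ | GeneratesLE G ℓ}

/-- `Γ` is a set of cycles of `G` generating its cycle space over GF(2). -/
def GeneratesSet {V : Type u} (G : SimpleGraph V) (Γ : Set (Σ v : V, G.Walk v v)) : Prop :=
  (∀ c ∈ Γ, c.2.IsCycle) ∧
  ∀ ⦃v : V⦄ (p : G.Walk v v), p.IsCycle →
    walkChar p ∈ Submodule.span (ZMod 2) {f | ∃ c ∈ Γ, f = walkChar c.2}

/-- A bramble: a collection of connected vertex sets, any two of which have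
connected union. -/
def IsBramble {V : Type u} (G : SimpleGraph V) (B : Set (Set V)) : Prop :=
  (∀ S ∈ B, IsConnSet G S) ∧ ∀ S ∈ B, ∀ S' ∈ B, IsConnSet G (S ∪ S')

/-- `X` is a connected cover of the bramble `B`. -/
def IsConnCover {V : Type u} (G : SimpleGraph V) (B : Set (Set V)) (X : Set V) : Prop :=
  IsConnSet G X ∧ ∀ S ∈ B, (X ∩ S).Nonempty

/-- The connected order of a bramble: the least size of a connected cover. -/
noncomputable def connOrder {V : Type u} (G : SimpleGraph V) (B : Set (Set V)) : ℕ :=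
  sInf {n | ∃ X, IsConnCover G B X ∧ X.ncard = n}

/-- The maximum connected order of a bramble of `G`. -/
noncomputable def cbn {V : Type u} (G : SimpleGraph V) : ℕ :=
  sSup {n | ∃ B, IsBramble G B ∧ connOrder G B = n}

/-- A geodesic cycle: a cycle containing a shortest `G`-path between any two
of its vertices. -/
def IsGeodesicCycle {V : Type u} (G : SimpleGraph V) {v : V} (p : G.Walk v v) : Prop :=
  p.IsCycle ∧ ∀ x ∈ p.support, ∀ y ∈ p.support,
    ∃ q : G.Walk x y, q.length = G.dist x y ∧ ∀ e ∈ q.edges, e ∈ p.edges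

/-- The graph obtained from `K_n` by subdividing every edge exactly `k` times:
the edge between `i < j` is replaced by the path
`i, ((i,j),0), ((i,j),1), …, ((i,j),k-1), j`. -/
def subK (n k : ℕ) : SimpleGraph (Fin n ⊕ ({p : Fin n × Fin n // p.1 < p.2} × Fin k)) :=
  SimpleGraph.fromRel fun u v =>
    match u, v with
    | Sum.inl i, Sum.inl j => i < j ∧ k = 0
    | Sum.inl i, Sum.inr (e, c) =>
        (e.val.1 = i ∧ (c : ℕ) = 0) ∨ (e.val.2 = i ∧ (c : ℕ) = k - 1)
    | Sum.inr (e, c), Sum.inr (e', c') => e = e' ∧ (c' : ℕ) = (c : ℕ) + 1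
    | _, _ => False

namespace ConnIn

variable {V W : Type u} {G : SimpleGraph V} {S S' : Set V} {x y z : V}

theorem refl (h : x ∈ S) : ConnIn G S x x := ⟨.nil, by simpa using h⟩

theorem symm (h : ConnIn G S x y) : ConnIn G S y x := by
  obtain ⟨p, hp⟩ := h
  exact ⟨p.reverse, by simpa using hp⟩

theorem trans (h : ConnIn G S x y) (h' : ConnIn G S y z) : ConnIn G S x z := by
  obtain ⟨p, hp⟩ := h
  obtain ⟨q, hq⟩ := h'
  refine ⟨p.append q, fun v hv => ?_⟩
  rw [Walk.mem_support_append_iff] at hv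
  exact hv.elim (hp v) (hq v)

theorem mono (hS : S ⊆ S') (h : ConnIn G S x y) : ConnIn G S' x y := by
  obtain ⟨p, hp⟩ := h
  exact ⟨p, fun v hv => hS (hp v hv)⟩

theorem of_adj (h : G.Adj x y) (hx : x ∈ S) (hy : y ∈ S) : ConnIn G S x y :=
  ⟨h.toWalk, by simp [hx, hy]⟩

theorem mem_left (h : ConnIn G S x y) : x ∈ S := by
  obtain ⟨p, hp⟩ := h
  exact hp x p.start_mem_support

theorem mem_right (h : ConnIn G S x y) : y ∈ S := h.symm.mem_left

theorem map {H : SimpleGraph W} {R : Set W} (f : V → W) (hf : ∀ v ∈ S, f v ∈ R)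
    (hadj : ∀ u ∈ S, ∀ v ∈ S, G.Adj u v → ConnIn H R (f u) (f v)) (h : ConnIn G S x y) :
    ConnIn H R (f x) (f y) := by
  obtain ⟨p, hp⟩ := h
  induction p with
  | nil => exact .refl (hf _ (hp _ (by simp)))
  | cons h p ih =>
    simp only [Walk.support_cons, List.mem_cons, forall_eq_or_imp] at hp
    exact (hadj _ hp.1 _ (hp.2 _ p.start_mem_support) h).trans (ih hp.2)

end ConnIn

theorem SimpleGraph.Reachable.map_of_adj {V W : Type u} {G : SimpleGraph V} {H : SimpleGraph W}
    (f : V → W) (hadj : ∀ ⦃u v⦄, G.Adj u v → H.Reachable (f u) (f v)) {x y : V}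
    (h : G.Reachable x y) : H.Reachable (f x) (f y) := by
  obtain ⟨p⟩ := h
  induction p with
  | nil => rfl
  | cons h _ ih => exact (hadj h).trans ih

/-- In an acyclic graph, a path stays inside any set in which its ends are connected. -/
theorem ConnIn.support_subset {ι : Type u} {T : SimpleGraph ι} (hT : T.IsAcyclic) {S : Set ι}
    {x y : ι} (h : ConnIn T S x y) (p : T.Walk x y) (hp : p.IsPath) : ∀ z ∈ p.support, z ∈ S := by
  classical
  obtain ⟨q, hq⟩ := h
  have hpq : (⟨p, hp⟩ : T.Path x y) = q.toPath := (hT.subsingleton_path x y).elim _ _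
  intro z hz
  refine hq z (q.support_toPath_subset_support ?_)
  rwa [← hpq]

theorem TreeDecomp.connIn {V ι : Type u} {G : SimpleGraph V} {T : SimpleGraph ι}
    (td : TreeDecomp G T) {v : V} {s t : ι} (hs : v ∈ td.bag s) (ht : v ∈ td.bag t) :
    ConnIn T {u | v ∈ td.bag u} s t := by
  obtain ⟨p, hp, -⟩ := td.isTree.existsUnique_path s t
  exact ⟨p, fun u hu => td.bag_sep p hp u hu ⟨hs, ht⟩⟩

/-- Two disjoint copies of `T` joined by an edge between the two copies of `t`. -/
def doubleTree {ι : Type u} (T : SimpleGraph ι) (t : ι) : SimpleGraph (ι ⊕ ι) where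
  Adj x y := match x, y with
    | .inl a, .inl b => T.Adj a b
    | .inr a, .inr b => T.Adj a b
    | .inl a, .inr b => a = t ∧ b = t
    | .inr a, .inl b => a = t ∧ b = t
  symm := ⟨by rintro (a | a) (b | b) h <;> exact h.symm⟩
  loopless := ⟨by rintro (a | a) h <;> exact T.loopless.irrefl a h⟩

theorem isTree_doubleTree {ι : Type u} {T : SimpleGraph ι} (hT : T.IsTree) (t : ι) :
    (doubleTree T t).IsTree := by
  have hl : ∀ a, (doubleTree T t).Reachable (.inl a) (.inl t) := fun a =>
    (hT.connected.preconnected a t).map_of_adj Sum.inl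
      fun u v h => Adj.reachable (G := doubleTree T t) (u := .inl u) (v := .inl v) h
  have hr : ∀ a, (doubleTree T t).Reachable (.inr a) (.inl t) := fun a =>
    ((hT.connected.preconnected a t).map_of_adj Sum.inr
      fun u v h => Adj.reachable (G := doubleTree T t) (u := .inr u) (v := .inr v) h).trans
      (Adj.reachable (G := doubleTree T t) (u := .inr t) (v := .inl t) ⟨rfl, rfl⟩)
  have hroot : ∀ x, (doubleTree T t).Reachable x (.inl t) := by
    rintro (a | a)
    exacts [hl a, hr a]
  have : Nonempty (ι ⊕ ι) := ⟨.inl t⟩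
  refine ⟨⟨fun x y => (hroot x).trans (hroot y).symm⟩, ?_⟩
  have hTb := isAcyclic_iff_forall_adj_isBridge.1 hT.isAcyclic
  rw [isAcyclic_iff_forall_adj_isBridge]
  have hmid : ¬ ((doubleTree T t).deleteEdges {s(Sum.inl t, Sum.inr t)}).Reachable
      (Sum.inl t) (Sum.inr t) := by
    intro h
    have := h.map_of_adj (H := (⊥ : SimpleGraph (ULift.{u} Bool))) (fun x => ⟨x.isLeft⟩) (by
      rintro (a | a) (b | b) h <;> simp [doubleTree] at h ⊢
      · exact h.2 h.1.1 h.1.2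
      · exact h.2 h.1.1 h.1.2)
    simp at this
  rintro (a | a) (b | b) hab
  · intro h
    refine hTb (v := a) (w := b) hab (h.map_of_adj (Sum.elim id fun _ => t) ?_)
    rintro (c | c) (d | d) h <;> simp only [doubleTree, deleteEdges_adj] at h
    · exact Adj.reachable (by simpa [deleteEdges_adj] using h)
    · obtain ⟨⟨rfl, rfl⟩, -⟩ := h; rfl
    · obtain ⟨⟨rfl, rfl⟩, -⟩ := h; rfl
    · rfl
  · obtain ⟨rfl, rfl⟩ := hab
    exact hmid
  · obtain ⟨rfl, rfl⟩ := hab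
    rw [Sym2.eq_swap]
    exact hmid
  · intro h
    refine hTb (v := a) (w := b) hab (h.map_of_adj (Sum.elim (fun _ => t) id) ?_)
    rintro (c | c) (d | d) h <;> simp only [doubleTree, deleteEdges_adj] at h
    · rfl
    · obtain ⟨⟨rfl, rfl⟩, -⟩ := h; rfl
    · obtain ⟨⟨rfl, rfl⟩, -⟩ := h; rfl
    · exact Adj.reachable (by simpa [deleteEdges_adj] using h)

/-- Splitting a tree-decomposition along a separation `(L, R)` whose separator lies in a bag. -/
def TreeDecomp.split {V ι : Type u} {G : SimpleGraph V} {T : SimpleGraph ι}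
    (td : TreeDecomp G T) (t : ι) (L R : Set V) (hLR : ∀ v, v ∈ L ∨ v ∈ R)
    (hadj : ∀ ⦃u v⦄, G.Adj u v → u ∈ L ∧ v ∈ L ∨ u ∈ R ∧ v ∈ R) (ht : L ∩ R ⊆ td.bag t) :
    TreeDecomp G (doubleTree T t) where
  isTree := isTree_doubleTree td.isTree t
  bag := Sum.elim (fun s => td.bag s ∩ L) (fun s => td.bag s ∩ R)
  exists_bag v := by
    obtain ⟨s, hs⟩ := td.exists_bag v
    exact (hLR v).elim (fun h => ⟨.inl s, hs, h⟩) (fun h => ⟨.inr s, hs, h⟩)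
  exists_bag_adj u v huv := by
    obtain ⟨s, hu, hv⟩ := td.exists_bag_adj huv
    exact (hadj huv).elim (fun h => ⟨.inl s, ⟨hu, h.1⟩, hv, h.2⟩)
      (fun h => ⟨.inr s, ⟨hu, h.1⟩, hv, h.2⟩)
  bag_sep := by
    let bag' : ι ⊕ ι → Set V := Sum.elim (fun s => td.bag s ∩ L) (fun s => td.bag s ∩ R)
    intro x y p hp z hz v hv
    have hl : ∀ a b, v ∈ td.bag a ∩ L → v ∈ td.bag b ∩ L →
        ConnIn (doubleTree T t) {s | v ∈ bag' s} (.inl a) (.inl b) := fun a b ha hb =>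
      (td.connIn ha.1 hb.1).map Sum.inl (fun s hs => ⟨hs, ha.2⟩)
        fun c hc d hd h => .of_adj (G := doubleTree T t) (x := .inl c) (y := .inl d) h
          ⟨hc, ha.2⟩ ⟨hd, ha.2⟩
    have hr : ∀ a b, v ∈ td.bag a ∩ R → v ∈ td.bag b ∩ R →
        ConnIn (doubleTree T t) {s | v ∈ bag' s} (.inr a) (.inr b) := fun a b ha hb =>
      (td.connIn ha.1 hb.1).map Sum.inr (fun s hs => ⟨hs, ha.2⟩)
        fun c hc d hd h => .of_adj (G := doubleTree T t) (x := .inr c) (y := .inr d) h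
          ⟨hc, ha.2⟩ ⟨hd, ha.2⟩
    have hm : ∀ a b, v ∈ td.bag a ∩ L → v ∈ td.bag b ∩ R →
        ConnIn (doubleTree T t) {s | v ∈ bag' s} (.inl a) (.inr b) := fun a b ha hb => by
      have hv : v ∈ td.bag t := ht ⟨ha.2, hb.2⟩
      exact ((hl a t ha ⟨hv, ha.2⟩).trans
        (.of_adj (G := doubleTree T t) (x := .inl t) (y := .inr t) ⟨rfl, rfl⟩ ⟨hv, ha.2⟩
          ⟨hv, hb.2⟩)).trans (hr t b ⟨hv, hb.2⟩ hb)
    refine ConnIn.support_subset (isTree_doubleTree td.isTree t).isAcyclic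
      (S := {s | v ∈ bag' s}) ?_ p hp z hz
    rcases x with a | a <;> rcases y with b | b
    · exact hl a b hv.1 hv.2
    · exact hm a b hv.1 hv.2
    · exact (hm b a hv.2 hv.1).symm
    · exact hr a b hv.1 hv.2

/-- The tree-decomposition with a single bag. -/
def TreeDecomp.trivial {V : Type u} (G : SimpleGraph V) :
    TreeDecomp G (⊥ : SimpleGraph PUnit.{u + 1}) where
  isTree := .of_subsingleton
  bag _ := Set.univ
  exists_bag _ := ⟨⟨⟩, ⟨⟩⟩
  exists_bag_adj _ _ _ := ⟨⟨⟩, ⟨⟩, ⟨⟩⟩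
  bag_sep _ _ _ _ _ _ := Set.subset_univ _

/-- No bag is separated by a separation of `G` whose separator it contains. -/
def TreeDecomp.Tight {V ι : Type u} {G : SimpleGraph V} {T : SimpleGraph ι}
    (td : TreeDecomp G T) : Prop :=
  ∀ t, ∀ L R : Set V, (∀ v, v ∈ L ∨ v ∈ R) →
    (∀ ⦃u v⦄, G.Adj u v → u ∈ L ∧ v ∈ L ∨ u ∈ R ∧ v ∈ R) → L ∩ R ⊆ td.bag t →
    td.bag t ⊆ L ∨ td.bag t ⊆ R

theorem exists_width_le_treewidth {V : Type u} (G : SimpleGraph V) :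
    ∃ (ι : Type u) (T : SimpleGraph ι) (td : TreeDecomp G T),
      ∀ t, (td.bag t).ncard ≤ treewidth G + 1 :=
  Nat.sInf_mem (s := {k | ∃ (ι : Type u) (T : SimpleGraph ι) (td : TreeDecomp G T),
    ∀ t, (td.bag t).ncard ≤ k + 1})
    ⟨(Set.univ : Set V).ncard, _, _, .trivial G, fun _ => Nat.le_succ _⟩

/-- Every finite graph has a tight tree-decomposition of optimal width: one minimizing the number
of pairs of vertices that share a bag. -/
theorem exists_tight {V : Type u} [Finite V] (G : SimpleGraph V) :
    ∃ (ι : Type u) (T : SimpleGraph ι) (td : TreeDecomp G T),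
      (∀ t, (td.bag t).ncard ≤ treewidth G + 1) ∧ td.Tight := by
  let cov : ∀ {ι : Type u} {T : SimpleGraph ι}, TreeDecomp G T → Set (V × V) :=
    fun td => {q | ∃ t, q.1 ∈ td.bag t ∧ q.2 ∈ td.bag t}
  let N : Set ℕ := {n | ∃ (ι : Type u) (T : SimpleGraph ι) (td : TreeDecomp G T),
    (∀ t, (td.bag t).ncard ≤ treewidth G + 1) ∧ (cov td).ncard = n}
  have hN : N.Nonempty := by
    obtain ⟨ι, T, td, h⟩ := exists_width_le_treewidth G
    exact ⟨_, ι, T, td, h, rfl⟩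
  obtain ⟨ι, T, td, hw, hmin⟩ := Nat.sInf_mem hN
  refine ⟨ι, T, td, hw, fun t L R hLR hadj ht => ?_⟩
  by_contra! hcon
  obtain ⟨x, hx, hxL⟩ := Set.not_subset.1 hcon.1
  obtain ⟨y, hy, hyR⟩ := Set.not_subset.1 hcon.2
  have hlt : (cov (td.split t L R hLR hadj ht)).ncard < (cov td).ncard := by
    refine Set.ncard_lt_ncard (Set.ssubset_iff_of_subset ?_ |>.2 ⟨(x, y), ⟨t, hx, hy⟩, ?_⟩)
      (Set.toFinite _)
    · rintro q ⟨s | s, h₁, h₂⟩ <;> exact ⟨s, h₁.1, h₂.1⟩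
    · rintro ⟨s | s, h₁, h₂⟩
      · exact hxL h₁.2
      · exact hyR h₂.2
  refine (hlt.trans_eq hmin).not_ge (Nat.sInf_le ⟨_, _, td.split t L R hLR hadj ht, ?_, rfl⟩)
  rintro (s | s) <;>
    exact (Set.ncard_le_ncard Set.inter_subset_left (Set.toFinite _)).trans (hw s)

/-- The nodes whose bags meet a connected set are connected in the decomposition tree. -/
theorem TreeDecomp.connIn_meeting {V ι : Type u} {G : SimpleGraph V} {T : SimpleGraph ι}
    (td : TreeDecomp G T) {D : Set V} {x y : V} (h : ConnIn G D x y) {s t : ι}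
    (hs : x ∈ td.bag s) (ht : y ∈ td.bag t) : ConnIn T {u | (td.bag u ∩ D).Nonempty} s t := by
  have hsame : ∀ v ∈ D, ∀ s t, v ∈ td.bag s → v ∈ td.bag t →
      ConnIn T {u | (td.bag u ∩ D).Nonempty} s t := fun v hv s t hs ht =>
    (td.connIn hs ht).mono fun u hu => ⟨v, hu, hv⟩
  obtain ⟨p, hp⟩ := h
  induction p generalizing s with
  | nil => exact hsame _ (hp _ (by simp)) _ _ hs ht
  | cons h p ih =>
    simp only [Walk.support_cons, List.mem_cons, forall_eq_or_imp] at hp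
    obtain ⟨a, hua, hva⟩ := td.exists_bag_adj h
    exact (hsame _ hp.1 _ _ hs hua).trans (ih hva ht hp.2)

theorem exists_minimal_dist {ι : Type u} (T : SimpleGraph ι) (t : ι) {K : Set ι}
    (hK : K.Nonempty) : ∃ s ∈ K, ∀ s' ∈ K, T.dist t s ≤ T.dist t s' := by
  obtain ⟨s, hs⟩ := hK
  exact ⟨_, Function.argminOn_mem (T.dist t) K ⟨s, hs⟩,
    fun s' hs' => Function.argminOn_le (T.dist t) K hs'⟩

/-- If every vertex of a bag has a neighbour in the connected set `D`, then some bag contains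
that bag and meets `D`. -/
theorem TreeDecomp.exists_bag_superset {V ι : Type u} {G : SimpleGraph V} {T : SimpleGraph ι}
    (td : TreeDecomp G T) {D : Set V} (hD : IsConnSet G D) (t : ι)
    (hN : ∀ v ∈ td.bag t, ∃ d ∈ D, G.Adj v d) :
    ∃ s, td.bag t ⊆ td.bag s ∧ (td.bag s ∩ D).Nonempty := by
  classical
  have hK : {s | (td.bag s ∩ D).Nonempty}.Nonempty := by
    obtain ⟨d, hd⟩ := hD.1
    obtain ⟨s, hs⟩ := td.exists_bag d
    exact ⟨s, d, hs, hd⟩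
  obtain ⟨s, hsK, hmin⟩ := exists_minimal_dist T t hK
  obtain ⟨x, hxs, hxD⟩ := hsK
  refine ⟨s, fun v hv => ?_, x, hxs, hxD⟩
  obtain ⟨d, hd, hvd⟩ := hN v hv
  obtain ⟨s', hvs', hds'⟩ := td.exists_bag_adj hvd
  obtain ⟨q, hq⟩ := td.connIn_meeting (hD.2 x hxD d hd) hxs hds'
  obtain ⟨p, hp, hpl⟩ := td.isTree.connected.exists_path_of_dist t s
  have hqs : ∀ u ∈ q.bypass.support, (td.bag u ∩ D).Nonempty := fun u hu =>
    hq u (q.support_bypass_subset_support hu)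
  have hpath : (p.append q.bypass).IsPath := by
    rw [Walk.isPath_def, Walk.support_append, List.nodup_append]
    have hnd := q.bypass_isPath.support_nodup
    refine ⟨hp.support_nodup, hnd.tail, ?_⟩
    rintro u hup w huq rfl
    have h₁ := hmin u (hqs u (List.mem_of_mem_tail huq))
    have h₂ := dist_le (p.takeUntil u hup)
    have h₃ := congrArg Walk.length (p.take_spec hup)
    rw [Walk.length_append] at h₃
    have h₄ : u = s := Walk.eq_of_length_eq_zero (p := p.dropUntil u hup) (by omega)
    subst h₄
    rw [← Walk.cons_tail_support] at hnd
    exact (List.nodup_cons.1 hnd).1 huq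
  exact td.bag_sep _ hpath s (by simp) ⟨hv, hvs'⟩

/-- Along a walk the sum of a coboundary telescopes. -/
theorem sum_edges_coboundary {V : Type u} {G : SimpleGraph V} (c : Sym2 V → ZMod 2)
    (g : V → ZMod 2) {x y : V} (p : G.Walk x y)
    (h : ∀ u ∈ p.support, ∀ v ∈ p.support, G.Adj u v → c s(u, v) = g u + g v) :
    (p.edges.map c).sum = g x + g y := by
  induction p with
  | nil => simp [CharTwo.add_self_eq_zero]
  | @cons a b d hab p ih =>
    rw [Walk.edges_cons, List.map_cons, List.sum_cons,
      ih fun u hu v hv => h u (by simp [hu]) v (by simp [hv]), h a (by simp) b (by simp) hab]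
    linear_combination CharTwo.add_self_eq_zero (g b)

theorem sum_mul_walkChar {V : Type u} [Fintype V] {G : SimpleGraph V} (c : Sym2 V → ZMod 2)
    {x y : V} (p : G.Walk x y) (hp : p.IsTrail) :
    ∑ e, c e * walkChar p e = (p.edges.map c).sum := by
  classical
  rw [← List.sum_toFinset c hp.edges_nodup]
  simp [walkChar, Finset.sum_ite_mem, ← List.mem_toFinset]

/-- Two vertices on a closed walk of length `n` are joined by a walk of length at most `n / 2`. -/
theorem exists_walk_length_le_half {V : Type u} {G : SimpleGraph V} {v : V} (p : G.Walk v v)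
    {x y : V} (hx : x ∈ p.support) (hy : y ∈ p.support) :
    ∃ q : G.Walk x y, q.length ≤ p.length / 2 := by
  classical
  have hy' : y ∈ (p.rotate x hx).support := (p.mem_support_rotate_iff x hx).2 hy
  have h := congrArg Walk.length ((p.rotate x hx).take_spec hy')
  rw [Walk.length_append, Walk.length_rotate] at h
  by_cases h' : ((p.rotate x hx).takeUntil y hy').length ≤ p.length / 2
  · exact ⟨_, h'⟩
  · exact ⟨((p.rotate x hx).dropUntil y hy').reverse, by rw [Walk.length_reverse]; omega⟩

theorem generatesLE_ellGraph {V : Type u} [Finite V] (G : SimpleGraph V) :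
    GeneratesLE G (ellGraph G) := by
  classical
  have := Fintype.ofFinite V
  refine Nat.sInf_mem (s := {ℓ | GeneratesLE G ℓ}) ⟨G.edgeFinset.card, fun v p hp => ?_⟩
  exact Submodule.subset_span ⟨v, p, hp, hp.1.1.length_le_card_edgeFinset, rfl⟩

theorem three_le_ellGraph {V : Type u} [Finite V] (G : SimpleGraph V)
    (hc : ∃ (v : V) (p : G.Walk v v), p.IsCycle) : 3 ≤ ellGraph G := by
  obtain ⟨v, p, hp⟩ := hc
  by_contra! hlt
  have hempty : cycleChars G (ellGraph G) = ∅ := by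
    rw [Set.eq_empty_iff_forall_notMem]
    rintro f ⟨w, q, hq, hlen, -⟩
    have := hq.three_le_length
    omega
  have h := generatesLE_ellGraph G p hp
  rw [hempty, Submodule.span_empty, Submodule.mem_bot] at h
  obtain ⟨e, he⟩ := List.exists_mem_of_ne_nil p.edges fun h0 => by
    have := hp.three_le_length
    rw [← Walk.length_edges, h0] at this
    simp at this
  simpa [walkChar, he] using congrFun h e

/-- Let `D` be a connected set whose neighbours all lie in `A ∪ B`. If some `a ∈ A` and `b ∈ B`
both have neighbours in `D` and are connected outside `D`, then `A` and `B` are at distance at most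
half of `ℓ(G)`. -/
theorem exists_walk_length_le_ellGraph_half {V : Type u} [Finite V] {G : SimpleGraph V}
    {A B D : Set V} (hAB : Disjoint A B) (hAD : Disjoint A D) (hBD : Disjoint B D)
    (hND : ∀ d ∈ D, ∀ v, G.Adj d v → v ∈ D ∨ v ∈ A ∨ v ∈ B) {a b d d' : V} (ha : a ∈ A)
    (hb : b ∈ B) (had : G.Adj a d) (hdd' : ConnIn G D d d') (hd'b : G.Adj d' b)
    (hab : ConnIn G Dᶜ b a) :
    ∃ x ∈ A, ∃ y ∈ B, ∃ p : G.Walk x y, p.length ≤ ellGraph G / 2 := by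
  classical
  have := Fintype.ofFinite V
  by_contra! hfar
  rw [Set.disjoint_left] at hAB hAD hBD
  let F : Set (Sym2 V) := {e | ∃ x ∈ A, ∃ y ∈ D, e = s(x, y)}
  have hF : ∀ u v, s(u, v) ∈ F ↔ u ∈ A ∧ v ∈ D ∨ u ∈ D ∧ v ∈ A := by
    intro u v
    constructor
    · rintro ⟨x, hx, y, hy, h⟩
      rcases Sym2.eq_iff.1 h with ⟨rfl, rfl⟩ | ⟨rfl, rfl⟩
      exacts [.inl ⟨hx, hy⟩, .inr ⟨hy, hx⟩]
    · rintro (⟨hu, hv⟩ | ⟨hu, hv⟩)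
      exacts [⟨u, hu, v, hv, rfl⟩, ⟨v, hv, u, hu, Sym2.eq_swap⟩]
  let c : Sym2 V → ZMod 2 := fun e => if e ∈ F then 1 else 0
  let φ : (Sym2 V → ZMod 2) →ₗ[ZMod 2] ZMod 2 := ∑ e, c e • LinearMap.proj e
  have hφ : ∀ f, φ f = ∑ e, c e * f e := fun f => by simp [φ, LinearMap.sum_apply]
  have hshort : Submodule.span (ZMod 2) (cycleChars G (ellGraph G)) ≤ LinearMap.ker φ := by
    rw [Submodule.span_le]
    rintro f ⟨v, p, hp, hlen, rfl⟩
    rw [SetLike.mem_coe, LinearMap.mem_ker, hφ, sum_mul_walkChar c p hp.1.1]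
    have hmeet : (∀ x ∈ p.support, x ∉ A) ∨ ∀ y ∈ p.support, y ∉ B := by
      by_contra! h
      obtain ⟨⟨x, hx, hxA⟩, y, hy, hyB⟩ := h
      obtain ⟨q, hq⟩ := exists_walk_length_le_half p hx hy
      have := hfar x hxA y hyB q
      omega
    rcases hmeet with h | h
    · rw [sum_edges_coboundary c 0 p]
      · simp
      · intro u hu v hv _
        have : s(u, v) ∉ F := by
          rw [hF]
          rintro (h' | h')
          exacts [h u hu h'.1, h v hv h'.2]
        simp [c, this]
    · rw [sum_edges_coboundary c (fun v => if v ∈ D then 1 else 0) p]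
      · exact CharTwo.add_self_eq_zero _
      · intro u hu v hv huv
        have h₁ := hND u
        have h₂ := hND v
        have h₃ := h u hu
        have h₄ := h v hv
        have h₅ := hAD (a := u)
        have h₆ := hAD (a := v)
        have h₇ : (1 : ZMod 2) + 1 = 0 := rfl
        by_cases hu' : u ∈ D <;> by_cases hv' : v ∈ D
        · simp [c, hF, hu', hv', h₅.mt, h₆.mt, h₇]
        · have : v ∈ A := by have := h₁ hu' v huv; tauto
          simp [c, hF, hu', hv', this]
        · have : u ∈ A := by have := h₂ hv' u huv.symm; tauto
          simp [c, hF, hu', hv', this]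
        · simp [c, hF, hu', hv']
  have hstep : ∀ {u v}, G.Adj u v → s(u, v) ∉ F → (G.deleteEdges F).Reachable u v :=
    fun h h' => Adj.reachable (deleteEdges_adj.2 ⟨h, h'⟩)
  have hlift : ∀ {S : Set V} {u v}, (∀ x ∈ S, ∀ y ∈ S, s(x, y) ∉ F) → ConnIn G S u v →
      (G.deleteEdges F).Reachable u v := by
    rintro S u v hS ⟨p, hp⟩
    induction p with
    | nil => rfl
    | cons h p ih =>
      simp only [Walk.support_cons, List.mem_cons, forall_eq_or_imp] at hp
      exact (hstep h (hS _ hp.1 _ (hp.2 _ p.start_mem_support))).trans (ih hp.2)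
  have hda : (G.deleteEdges F).Reachable d a := by
    refine ((hlift ?_ hdd').trans (hstep hd'b ?_)).trans (hlift ?_ hab)
    · intro x hx y hy h
      rcases (hF x y).1 h with h | h
      exacts [hAD h.1 hx, hAD h.2 hy]
    · intro h
      rcases (hF d' b).1 h with h | h
      exacts [hBD hb h.2, hAB h.2 hb]
    · intro x hx y hy h
      rcases (hF x y).1 h with h | h
      exacts [hy h.2, hx h.1]
  obtain ⟨q, hq⟩ := hda.exists_isPath
  have hqF : ∀ e ∈ q.edges, e ∉ F := fun e he => by
    have := q.edges_subset_edgeSet he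
    rw [edgeSet_deleteEdges] at this
    exact this.2
  have hle : G.deleteEdges F ≤ G := deleteEdges_le _
  have hadF : s(a, d) ∈ F := (hF a d).2 (.inl ⟨ha, hdd'.mem_left⟩)
  have hcyc : (Walk.cons had (q.mapLe hle)).IsCycle := by
    rw [Walk.cons_isCycle_iff, Walk.edges_mapLe_eq_edges]
    exact ⟨hq.mapLe hle, fun h => hqF _ h hadF⟩
  have hzero := hshort (generatesLE_ellGraph G _ hcyc)
  rw [LinearMap.mem_ker, hφ, sum_mul_walkChar c _ hcyc.1.1, Walk.edges_cons,
    Walk.edges_mapLe_eq_edges, List.map_cons, List.sum_cons, List.sum_eq_zero] at hzero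
  · simp [c, hadF] at hzero
  · intro z hz
    obtain ⟨e, he, rfl⟩ := List.mem_map.1 hz
    simp [c, hqF e he]

/-- A walk from `A` to `B` contains an `A`–`B` edge or an `A`–`B` path with interior outside
`A ∪ B`. -/
theorem exists_adj_or_connIn_compl {V : Type u} {G : SimpleGraph V} {A B : Set V} {x y : V}
    (p : G.Walk x y) (hy : y ∈ B) (hAB : Disjoint A B)
    (hx : x ∈ A ∨ ∃ a ∈ A, ∃ d, G.Adj a d ∧ ConnIn G (A ∪ B)ᶜ d x) :
    ∃ a ∈ A, ∃ b ∈ B, G.Adj a b ∨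
      ∃ d d', G.Adj a d ∧ ConnIn G (A ∪ B)ᶜ d d' ∧ G.Adj d' b := by
  induction p with
  | nil =>
    rcases hx with hx | ⟨a, -, d, -, hd⟩
    · exact (Set.disjoint_left.1 hAB hx hy).elim
    · exact (hd.mem_right (.inr hy)).elim
  | @cons u v w huv p ih =>
    by_cases hvA : v ∈ A
    · exact ih hy (.inl hvA)
    by_cases hvB : v ∈ B
    · rcases hx with hx | ⟨a, ha, d, had, hd⟩
      · exact ⟨u, hx, v, hvB, .inl huv⟩
      · exact ⟨a, ha, v, hvB, .inr ⟨d, u, had, hd, huv⟩⟩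
    have hv : v ∈ (A ∪ B)ᶜ := by simp [hvA, hvB]
    refine ih hy (.inr ?_)
    rcases hx with hx | ⟨a, ha, d, had, hd⟩
    · exact ⟨u, hx, v, huv, .refl hv⟩
    · exact ⟨a, ha, d, had, hd.trans (.of_adj huv hd.mem_right hv)⟩

/-- In a tight tree-decomposition, any two parts of a bipartition of an inclusion-maximal bag are
joined by a walk of length at most half of `ℓ(G)`. -/
theorem TreeDecomp.Tight.exists_walk {V ι : Type u} [Finite V] {G : SimpleGraph V}
    {T : SimpleGraph ι} {td : TreeDecomp G T} (htight : td.Tight) {t : ι}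
    (hmax : ∀ s, td.bag t ⊆ td.bag s → td.bag s ⊆ td.bag t)
    (hell : 1 ≤ ellGraph G / 2) {A B : Set V} (hAB : Disjoint A B) (hbag : A ∪ B = td.bag t)
    (hA : A.Nonempty) (hB : B.Nonempty) :
    ∃ x ∈ A, ∃ y ∈ B, ∃ p : G.Walk x y, p.length ≤ ellGraph G / 2 := by
  obtain ⟨a₀, ha₀⟩ := hA
  obtain ⟨b₀, hb₀⟩ := hB
  have hreach : G.Reachable a₀ b₀ := by
    have hsep : td.bag t ⊆ {v | G.Reachable a₀ v} ∨ td.bag t ⊆ {v | ¬ G.Reachable a₀ v} := by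
      refine htight t _ _ (fun v => em _) (fun u v h => ?_) (fun v hv => (hv.2 hv.1).elim)
      by_cases hu : G.Reachable a₀ u
      · exact .inl ⟨hu, hu.trans h.reachable⟩
      · exact .inr ⟨hu, fun hv => hu (hv.trans h.symm.reachable)⟩
    rcases hsep with h | h
    · exact h (hbag ▸ .inr hb₀)
    · exact (h (hbag ▸ .inl ha₀ : a₀ ∈ td.bag t) .rfl).elim
  obtain ⟨p⟩ := hreach
  obtain ⟨a, ha, b, hb, h | ⟨d, d', had, hdd', hd'b⟩⟩ :=
    exists_adj_or_connIn_compl p hb₀ hAB (.inl ha₀)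
  · exact ⟨a, ha, b, hb, h.toWalk, by simpa using hell⟩
  rw [hbag] at hdd'
  let D : Set V := {v | ConnIn G (td.bag t)ᶜ d v}
  have hDconn : ∀ v, ConnIn G (td.bag t)ᶜ d v → ConnIn G D d v := by
    rintro v ⟨q, hq⟩
    classical
    exact ⟨q, fun w hw => ⟨q.takeUntil w hw,
      fun z hz => hq z (q.support_takeUntil_subset_support hw hz)⟩⟩
  have hdD : d ∈ D := .refl hdd'.mem_left
  have hD : IsConnSet G D :=
    ⟨⟨d, hdD⟩, fun x hx y hy => (hDconn x hx).symm.trans (hDconn y hy)⟩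
  have hDbag : ∀ v ∈ D, v ∉ td.bag t := fun v hv => hv.mem_right
  have hND : ∀ v ∈ D, ∀ w, G.Adj v w → w ∈ D ∨ w ∈ td.bag t := by
    intro v hv w hvw
    by_cases hw : w ∈ td.bag t
    · exact .inr hw
    · exact .inl (hv.trans (.of_adj hvw hv.mem_right hw))
  obtain ⟨w, hwt, hwD⟩ : ∃ w ∈ td.bag t, ∀ d ∈ D, ¬ G.Adj w d := by
    by_contra! h
    obtain ⟨s, hts, x, hxs, hxD⟩ := td.exists_bag_superset hD t h
    exact hDbag x hxD (hmax s hts hxs)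
  have hbagP : td.bag t ⊆ {v | ConnIn G Dᶜ w v} := by
    have hsep : td.bag t ⊆ {v | ConnIn G Dᶜ w v} ∨
        td.bag t ⊆ {v | ConnIn G Dᶜ w v → ∃ d ∈ D, G.Adj v d} := by
      refine htight t _ _ (fun v => ?_) (fun u v huv => ?_) (fun v hv => ?_)
      · by_cases h : ConnIn G Dᶜ w v
        exacts [.inl h, .inr fun h' => (h h').elim]
      · have key : ∀ {u v}, G.Adj u v → ConnIn G Dᶜ w u → ¬ ConnIn G Dᶜ w v → v ∈ D := by
          intro u v huv hu hv
          by_contra hvD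
          exact hv (hu.trans (.of_adj huv hu.mem_right hvD))
        by_cases hu : ConnIn G Dᶜ w u <;> by_cases hv : ConnIn G Dᶜ w v
        · exact .inl ⟨hu, hv⟩
        · exact .inr ⟨fun _ => ⟨v, key huv hu hv, huv⟩, fun h => (hv h).elim⟩
        · exact .inr ⟨fun h => (hu h).elim, fun _ => ⟨u, key huv.symm hv hu, huv.symm⟩⟩
        · exact .inr ⟨fun h => (hu h).elim, fun h => (hv h).elim⟩
      · obtain ⟨d, hd, hvd⟩ := hv.2 hv.1
        exact (hND d hd v hvd.symm).resolve_left hv.1.mem_right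
    rcases hsep with h | h
    · exact h
    · obtain ⟨d, hd, hwd⟩ := h hwt (.refl fun h => hDbag w h hwt)
      exact (hwD d hd hwd).elim
  have hAt : A ⊆ td.bag t := hbag ▸ Set.subset_union_left
  have hBt : B ⊆ td.bag t := hbag ▸ Set.subset_union_right
  refine exists_walk_length_le_ellGraph_half hAB
    (Set.disjoint_left.2 fun v hv hvD => hDbag v hvD (hAt hv))
    (Set.disjoint_left.2 fun v hv hvD => hDbag v hvD (hBt hv))
    (fun v hv w hvw => (hND v hv w hvw).imp_right fun h => ?_) ha hb had (hDconn d' hdd') hd'b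
    ((hbagP (hBt hb)).symm.trans (hbagP (hAt ha)))
  rwa [← hbag] at h

/-- If any two parts of a bipartition of `S` are joined by a walk of length at most `h`, then `S`
lies in a connected set of size at most `(|S| - 1) * h + 1`. -/
theorem exists_isConnSet_superset {V : Type u} [Finite V] {G : SimpleGraph V} {S : Set V} {h : ℕ}
    (hS : S.Nonempty)
    (hwalk : ∀ A B : Set V, Disjoint A B → A ∪ B = S → A.Nonempty → B.Nonempty →
      ∃ x ∈ A, ∃ y ∈ B, ∃ p : G.Walk x y, p.length ≤ h) :
    ∃ X, S ⊆ X ∧ IsConnSet G X ∧ X.ncard ≤ (S.ncard - 1) * h + 1 := by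
  classical
  let good : Set V → Prop := fun A => A ⊆ S ∧ A.Nonempty ∧
    ∃ X, A ⊆ X ∧ IsConnSet G X ∧ X.ncard ≤ (A.ncard - 1) * h + 1
  obtain ⟨v, hv⟩ := hS
  have hgood : good {v} := by
    refine ⟨by simpa using hv, by simp, {v}, subset_rfl, ⟨by simp, ?_⟩, by simp⟩
    rintro x rfl y rfl
    exact .refl rfl
  obtain ⟨A, -, ⟨hAS, hA, X, hAX, hX, hcard⟩, hmax⟩ := Finite.exists_le_maximal hgood
  by_cases hSA : S ⊆ A
  · rw [hAS.antisymm hSA] at hAX hcard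
    exact ⟨X, hAX, hX, hcard⟩
  obtain ⟨x, hx, y, hy, p, hp⟩ := hwalk A (S \ A) Set.disjoint_sdiff_right
    (Set.union_sdiff_cancel hAS) hA (Set.nonempty_of_not_subset hSA)
  have hPX : ∀ w ∈ X ∪ {w | w ∈ p.support}, ConnIn G (X ∪ {w | w ∈ p.support}) x w := by
    rintro w (hw | hw)
    · exact (hX.2 x (hAX hx) w hw).mono Set.subset_union_left
    · exact ⟨p.takeUntil w hw,
        fun z hz => .inr (p.support_takeUntil_subset_support hw hz)⟩
  have hnew : good (insert y A) := by
    refine ⟨Set.insert_subset hy.1 hAS, by simp, X ∪ {w | w ∈ p.support}, ?_, ⟨?_, ?_⟩, ?_⟩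
    · exact Set.insert_subset (.inr p.end_mem_support) (hAX.trans Set.subset_union_left)
    · exact ⟨x, .inl (hAX hx)⟩
    · exact fun u hu w hw => (hPX u hu).symm.trans (hPX w hw)
    · have hsub : X ∪ {w | w ∈ p.support} ⊆ X ∪ ↑p.support.tail.toFinset := by
        rintro w (hw | hw)
        · exact .inl hw
        · rcases Walk.mem_support_iff p |>.1 hw with rfl | hw
          exacts [.inl (hAX hx), .inr (by simpa using hw)]
      have h₁ := (Set.ncard_le_ncard hsub (Set.toFinite _)).trans (Set.ncard_union_le _ _)
      rw [Set.ncard_coe_finset] at h₁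
      have h₂ := p.support.tail.toFinset_card_le
      have h₃ : p.support.tail.length = p.length := by simp
      rw [Set.ncard_insert_of_notMem hy.2 (Set.toFinite _), Nat.add_sub_cancel]
      obtain ⟨n, hn⟩ := Nat.exists_eq_succ_of_ne_zero
        ((Set.ncard_pos (Set.toFinite A)).2 hA).ne'
      rw [hn, Nat.succ_sub_one] at hcard
      rw [hn, Nat.succ_mul]
      omega
  exact (hy.2 (hmax hnew (Set.subset_insert _ _) (Set.mem_insert _ _))).elim

/-- a graph containing a cycle has a tree-decomposition of
width `tw(G)` each of whose parts is contained in a connected set of at most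
`tw(G)·⌊ℓ(G)/2⌋ + 1` vertices; consequently `wctw(G) ≤ tw(G)·⌊ℓ(G)/2⌋`. -/
theorem wctw_bound {V : Type u} [Finite V] (G : SimpleGraph V)
    (hc : ∃ (v : V) (p : G.Walk v v), p.IsCycle) :
    (∃ (ι : Type u) (T : SimpleGraph ι) (td : TreeDecomp G T),
      (∀ t, (td.bag t).ncard ≤ treewidth G + 1) ∧
      ∀ t, ∃ X, td.bag t ⊆ X ∧ IsConnSet G X ∧
        X.ncard ≤ treewidth G * (ellGraph G / 2) + 1) ∧
    wctw G ≤ treewidth G * (ellGraph G / 2) := by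
  obtain ⟨ι, T, td, hw, htight⟩ := exists_tight G
  have hell : 1 ≤ ellGraph G / 2 := by
    have := three_le_ellGraph G hc
    omega
  have hcover : ∀ t, ∃ X, td.bag t ⊆ X ∧ IsConnSet G X ∧
      X.ncard ≤ treewidth G * (ellGraph G / 2) + 1 := by
    intro t₀
    obtain ⟨_, ht₀, ⟨t, rfl⟩, hmax⟩ := Finite.exists_le_maximal
      (p := fun S : Set V => ∃ t, td.bag t = S) ⟨t₀, rfl⟩
    rcases (td.bag t).eq_empty_or_nonempty with hempty | hne
    · obtain ⟨v, -⟩ := hc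
      refine ⟨{v}, (ht₀.trans hempty.le).trans (Set.empty_subset _), ⟨by simp, ?_⟩, by simp⟩
      rintro x rfl y rfl
      exact .refl rfl
    · obtain ⟨X, htX, hX, hcard⟩ := exists_isConnSet_superset hne
        fun A B hAB hbag hA hB =>
          htight.exists_walk (fun s hs => hmax ⟨s, rfl⟩ hs) hell hAB hbag hA hB
      refine ⟨X, ht₀.trans htX, hX, hcard.trans (Nat.succ_le_succ (Nat.mul_le_mul_right _ ?_))⟩
      exact Nat.sub_le_of_le_add (hw t)
  exact ⟨⟨ι, T, td, hw, hcover⟩, Nat.sInf_le ⟨ι, T, td, hcover⟩⟩
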